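/- Let g ≥ 2 be an integer, let k ≥ 2 be an integer, and let γ > 1 be the positive real root of X^k − X^{k−1} − ⋯ − X − 1 = 0 (a 'pseudo-golden mean' number). For Lebesgue-almost every x ∈ [0,1), the number m_g^{(γ)}(x,n) of γ-expansion digits of x determined by its first n g-adic digits satisfies lim_{n→∞} m_g^{(γ)}(x,n)/n = log g / log γ. -/

import Mathlib

open MeasureTheory Filter Set

/-- The `g`-adic cylinder of rank `n` containing `x`. -/
noncomputable def radixCyl (g : ℕ) (n : ℕ) (x : ℝ) : Set ℝ :=
  Set.Ico ((⌊(g : ℝ) ^ n * x⌋ : ℝ) / (g : ℝ) ^ n) (((⌊(g : ℝ) ^ n * x⌋ : ℝ) + 1) / (g : ℝ) ^ n)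

/-- The `γ`-transformation `x ↦ γx mod 1`. -/
noncomputable def betaMap (γ : ℝ) (x : ℝ) : ℝ := γ * x - ⌊γ * x⌋

/-- `betaDigit γ i x` is the `(i+1)`-st digit `d_{i+1}(x) = ⌊γ · T_γ^i(x)⌋` of the
`γ`-expansion of `x`. -/
noncomputable def betaDigit (γ : ℝ) (i : ℕ) (x : ℝ) : ℤ := ⌊γ * (betaMap γ)^[i] x⌋

/-- The number of `γ`-expansion digits of `x` determined by its first `n` `g`-adic digits. -/
noncomputable def mRadixBeta (g : ℕ) (γ : ℝ) (x : ℝ) (n : ℕ) : ℕ :=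
  sSup {m : ℕ | ∀ y ∈ radixCyl g n x, ∀ i < m, betaDigit γ i y = betaDigit γ i x}

lemma bm_iter_nonneg (γ z : ℝ) (hz : 0 ≤ z) (i : ℕ) : 0 ≤ (betaMap γ)^[i] z := by
  cases i with
  | zero => simpa using hz
  | succ i =>
    rw [Function.iterate_succ_apply']
    exact Int.fract_nonneg _

lemma bm_succ (γ z : ℝ) (i : ℕ) :
    (betaMap γ)^[i + 1] z = γ * (betaMap γ)^[i] z - betaDigit γ i z := by
  rw [Function.iterate_succ_apply']; rfl

lemma bm_succ_lt (γ z : ℝ) (i : ℕ) : (betaMap γ)^[i + 1] z < 1 := by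
  rw [Function.iterate_succ_apply']
  exact Int.fract_lt_one _

lemma bm_digit_nonneg (γ z : ℝ) (hγ : 1 < γ) (hz : 0 ≤ z) (i : ℕ) : 0 ≤ betaDigit γ i z :=
  Int.floor_nonneg.2 (mul_nonneg (by linarith) (bm_iter_nonneg γ z hz i))

/-- Linearity to the left of a point. -/
lemma bm_left (γ : ℝ) (hγ : 1 < γ) (z t : ℝ) (hz : 0 ≤ z) (ht : 0 ≤ t) (i : ℕ)
    (h : γ ^ i * t ≤ (betaMap γ)^[i] z) :
    (betaMap γ)^[i] (z - t) = (betaMap γ)^[i] z - γ ^ i * t := by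
  induction i with
  | zero => simp
  | succ i ih =>
    have hs := bm_succ γ z i
    have hd : (0 : ℝ) ≤ betaDigit γ i z := by exact_mod_cast bm_digit_nonneg γ z hγ hz i
    have h1 : γ ^ i * t ≤ (betaMap γ)^[i] z := by
      have : γ * (γ ^ i * t) ≤ γ * (betaMap γ)^[i] z := by
        rw [hs, pow_succ] at h
        nlinarith
      exact le_of_mul_le_mul_left this (by linarith)
    have h2 := ih h1
    have hf : betaDigit γ i (z - t) = betaDigit γ i z := by
      have hlt := bm_succ_lt γ z i
      have hp : 0 ≤ γ ^ (i + 1) * t := by positivity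
      unfold betaDigit at hs ⊢
      rw [h2, Int.floor_eq_iff]
      rw [pow_succ] at h hp
      constructor <;> nlinarith
    rw [bm_succ, bm_succ, hf, h2]
    ring

lemma bm_lin (γ : ℝ) (x y : ℝ) (m : ℕ) (h : ∀ i < m, betaDigit γ i y = betaDigit γ i x) :
    (betaMap γ)^[m] y - (betaMap γ)^[m] x = γ ^ m * (y - x) := by
  induction m with
  | zero => simp
  | succ m ih =>
    have := ih (fun i hi => h i (by omega))
    rw [bm_succ, bm_succ, h m (by omega), pow_succ]
    linear_combination γ * this

lemma bm_jump (γ : ℝ) (hγ : 1 < γ) (x y : ℝ) (hx : 0 ≤ x) (hxy : x ≤ y) (m : ℕ)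
    (h : ∀ i < m, betaDigit γ i y = betaDigit γ i x) (hne : betaDigit γ m y ≠ betaDigit γ m x) :
    ∃ z, x ≤ z ∧ z ≤ y ∧ (betaMap γ)^[m + 1] z = 0 ∧ 0 < (betaMap γ)^[m] z := by
  have hγ0 : 0 < γ := by linarith
  have hl := bm_lin γ x y m h
  have hle : (betaMap γ)^[m] x ≤ (betaMap γ)^[m] y := by
    have : 0 ≤ γ ^ m * (y - x) := mul_nonneg (by positivity) (by linarith)
    linarith
  have hdle : betaDigit γ m x ≤ betaDigit γ m y :=
    Int.floor_le_floor (mul_le_mul_of_nonneg_left hle hγ0.le)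
  have hdlt : betaDigit γ m x < betaDigit γ m y := lt_of_le_of_ne hdle (Ne.symm hne)
  have hd0 := bm_digit_nonneg γ x hγ hx m
  have hdpos : (0 : ℝ) < betaDigit γ m y := by exact_mod_cast lt_of_le_of_lt hd0 hdlt
  have hp : 0 < γ ^ (m + 1) := by positivity
  have hy : 0 ≤ y := hx.trans hxy
  have hT := bm_iter_nonneg γ y hy (m + 1)
  set t := (betaMap γ)^[m + 1] y / γ ^ (m + 1) with ht
  have ht0 : 0 ≤ t := by positivity
  have hte : γ ^ (m + 1) * t = (betaMap γ)^[m + 1] y := by rw [ht]; field_simp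
  have hs := bm_succ γ y m
  have e2 : γ * (γ ^ m * t) = γ * (betaMap γ)^[m] y - betaDigit γ m y := by
    rw [← hs, ← hte]; ring
  have hlt2 : γ ^ m * t < (betaMap γ)^[m] y := by
    refine lt_of_mul_lt_mul_left (a := γ) ?_ hγ0.le
    linarith
  refine ⟨y - t, ?_, by linarith, ?_, ?_⟩
  · have hxs : γ * (betaMap γ)^[m] x < betaDigit γ m x + 1 := Int.lt_floor_add_one _
    have : (betaDigit γ m x : ℝ) + 1 ≤ betaDigit γ m y := by exact_mod_cast hdlt
    have h3 : γ ^ (m + 1) * t ≤ γ ^ (m + 1) * (y - x) := by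
      have : γ ^ (m + 1) * (y - x) = γ * ((betaMap γ)^[m] y - (betaMap γ)^[m] x) := by
        rw [hl]; ring
      rw [this, hte, hs]; linarith
    have := le_of_mul_le_mul_left h3 hp
    linarith
  · rw [bm_left γ hγ y t hy ht0 (m + 1) hte.le, hte, sub_self]
  · rw [bm_left γ hγ y t hy ht0 m hlt2.le]; linarith

/-- Jump points of the digit of index `i`. -/
def jumpSet (γ : ℝ) (i : ℕ) : Set ℝ :=
  {z | 0 ≤ z ∧ z < 2 ∧ (betaMap γ)^[i + 1] z = 0 ∧ 0 < (betaMap γ)^[i] z}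

lemma jump_sep (γ : ℝ) (hγ : 1 < γ) (i : ℕ) (z zb : ℝ) (hz : z ∈ jumpSet γ i)
    (hzb : zb ∈ jumpSet γ i) (hlt : z < zb) : 1 ≤ γ ^ (i + 1) * (zb - z) := by
  by_contra! hc
  have hγ0 : 0 < γ := by linarith
  obtain ⟨a1, a2, a3, a4⟩ := hz
  obtain ⟨b1, b2, b3, b4⟩ := hzb
  rw [bm_succ] at a3 b3
  have hd : (0 : ℝ) < betaDigit γ i zb := by
    have := mul_pos hγ0 b4
    linarith
  have hd1 : (1 : ℝ) ≤ betaDigit γ i zb := by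
    have : 0 < betaDigit γ i zb := by exact_mod_cast hd
    exact_mod_cast this
  have hle : γ ^ i * (zb - z) ≤ (betaMap γ)^[i] zb := by
    refine le_of_mul_le_mul_left (a := γ) ?_ hγ0
    rw [pow_succ] at hc
    linarith
  have h := bm_left γ hγ zb (zb - z) b1 (by linarith) i hle
  rw [sub_sub_cancel] at h
  have e : (betaDigit γ i zb : ℝ) - betaDigit γ i z = γ ^ (i + 1) * (zb - z) := by
    rw [pow_succ]; linear_combination a3 - b3 - γ * h
  have hpos : 0 < γ ^ (i + 1) * (zb - z) := mul_pos (by positivity) (by linarith)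
  rw [← e] at hc hpos
  have h1 : betaDigit γ i zb - betaDigit γ i z < 1 := by exact_mod_cast hc
  have h2 : 0 < betaDigit γ i zb - betaDigit γ i z := by exact_mod_cast hpos
  omega

lemma jump_inj (γ : ℝ) (hγ : 1 < γ) (i : ℕ) :
    Set.InjOn (fun z : ℝ => ⌊γ ^ (i + 1) * z⌋₊) (jumpSet γ i) := by
  have key : ∀ z ∈ jumpSet γ i, ∀ zb ∈ jumpSet γ i,
      ⌊γ ^ (i + 1) * z⌋₊ = ⌊γ ^ (i + 1) * zb⌋₊ → ¬ z < zb := by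
    intro z hz zb hzb h hlt
    have h1 := jump_sep γ hγ i z zb hz hzb hlt
    have hγ0 : 0 < γ := by linarith
    have h2 := Nat.lt_floor_add_one (γ ^ (i + 1) * zb)
    have h3 := Nat.floor_le (a := γ ^ (i + 1) * z) (mul_nonneg (by positivity) hz.1)
    rw [h] at h3
    linarith
  intro z hz zb hzb h
  rcases lt_trichotomy z zb with hl | hl | hl
  · exact absurd hl (key z hz zb hzb h)
  · exact hl
  · exact absurd hl (key zb hzb z hz h.symm)

lemma jump_maps (γ : ℝ) (hγ : 1 < γ) (i : ℕ) :
    Set.MapsTo (fun z : ℝ => ⌊γ ^ (i + 1) * z⌋₊) (jumpSet γ i)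
      (Finset.range ⌈γ ^ (i + 1) * 2⌉₊ : Finset ℕ) := by
  intro z hz
  have hγ0 : 0 < γ := by linarith
  simp only [Finset.coe_range, Set.mem_Iio]
  rw [Nat.floor_lt (mul_nonneg (by positivity) hz.1)]
  exact (mul_lt_mul_of_pos_left hz.2.1 (by positivity)).trans_le (Nat.le_ceil _)

lemma jump_fin (γ : ℝ) (hγ : 1 < γ) (i : ℕ) : (jumpSet γ i).Finite :=
  Set.Finite.of_injOn (jump_maps γ hγ i) (jump_inj γ hγ i) (Finset.finite_toSet _)

lemma jump_card (γ : ℝ) (hγ : 1 < γ) (i : ℕ) :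
    ((jump_fin γ hγ i).toFinset.card : ℝ) ≤ 3 * γ ^ (i + 1) := by
  have h : (jump_fin γ hγ i).toFinset.card ≤ (Finset.range ⌈γ ^ (i + 1) * 2⌉₊).card := by
    apply Finset.card_le_card_of_injOn (fun z : ℝ => ⌊γ ^ (i + 1) * z⌋₊)
    · have := jump_maps γ hγ i
      simpa using this
    · have := jump_inj γ hγ i
      simpa using this
  rw [Finset.card_range] at h
  have h1 : (1 : ℝ) ≤ γ ^ (i + 1) := one_le_pow₀ hγ.le
  have h2 := Nat.ceil_lt_add_one (a := γ ^ (i + 1) * 2) (by positivity)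
  have h3 : ((jump_fin γ hγ i).toFinset.card : ℝ) ≤ (⌈γ ^ (i + 1) * 2⌉₊ : ℝ) := by exact_mod_cast h
  linarith

/-- The bad set. -/
def badSet (γ : ℝ) (m : ℕ) (ε : ℝ) : Set ℝ :=
  ⋃ i ∈ Finset.range m, ⋃ z ∈ jumpSet γ i, Metric.ball z ε

lemma bad_meas (γ : ℝ) (hγ : 1 < γ) (m : ℕ) (ε : ℝ) (hε : 0 ≤ ε) :
    volume (badSet γ m ε) ≤ ENNReal.ofReal (6 * (m * γ ^ m * ε)) := by
  have hγ0 : 0 < γ := by linarith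
  have h1 : ∀ i ∈ Finset.range m, volume (⋃ z ∈ jumpSet γ i, Metric.ball z ε) ≤
      ENNReal.ofReal (6 * (γ ^ m * ε)) := by
    intro i hi
    have : (⋃ z ∈ jumpSet γ i, Metric.ball z ε) =
        ⋃ z ∈ (jump_fin γ hγ i).toFinset, Metric.ball z ε := by simp
    rw [this]
    refine (measure_biUnion_finset_le _ _).trans ?_
    simp only [Real.volume_ball, Finset.sum_const, nsmul_eq_mul]
    rw [← ENNReal.ofReal_natCast, ← ENNReal.ofReal_mul (by positivity)]
    apply ENNReal.ofReal_le_ofReal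
    have h2 := jump_card γ hγ i
    have h3 : γ ^ (i + 1) ≤ γ ^ m := pow_le_pow_right₀ hγ.le (by simpa using hi)
    calc _ ≤ (3 * γ ^ m) * (2 * ε) := by gcongr; linarith
      _ = _ := by ring
  refine (measure_biUnion_finset_le _ _).trans ((Finset.sum_le_sum h1).trans ?_)
  simp only [Finset.sum_const, nsmul_eq_mul, Finset.card_range]
  rw [← ENNReal.ofReal_natCast, ← ENNReal.ofReal_mul (by positivity)]
  apply ENNReal.ofReal_le_ofReal
  exact le_of_eq (by ring)

lemma mem_cyl (g : ℕ) (hg : 2 ≤ g) (n : ℕ) (x : ℝ) : x ∈ radixCyl g n x := by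
  have hp : (0 : ℝ) < (g : ℝ) ^ n := by positivity
  refine ⟨?_, ?_⟩
  · rw [div_le_iff₀ hp, mul_comm]; exact Int.floor_le _
  · rw [lt_div_iff₀ hp, mul_comm]; exact Int.lt_floor_add_one _

lemma cyl_nonneg (g : ℕ) (n : ℕ) (x : ℝ) (hx : 0 ≤ x) (y : ℝ)
    (hy : y ∈ radixCyl g n x) : 0 ≤ y := by
  have : (0 : ℝ) ≤ (⌊(g : ℝ) ^ n * x⌋ : ℝ) := by
    exact_mod_cast Int.floor_nonneg.2 (by positivity)
  exact le_trans (by positivity) hy.1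

lemma cyl_dist (g : ℕ) (n : ℕ) (x y z : ℝ)
    (hy : y ∈ radixCyl g n x) (hz : z ∈ radixCyl g n x) : z - y < ((g : ℝ) ^ n)⁻¹ := by
  have h1 := hy.1
  have h2 := hz.2
  rw [add_div, one_div] at h2
  linarith

lemma m_upper (g : ℕ) (hg : 2 ≤ g) (γ : ℝ) (hγ : 1 < γ) (x : ℝ) (n m : ℕ)
    (hm : ∀ y ∈ radixCyl g n x, ∀ i < m, betaDigit γ i y = betaDigit γ i x) :
    γ ^ m ≤ (g : ℝ) ^ n := by
  have hp : (0 : ℝ) < (g : ℝ) ^ n := by positivity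
  have hγ0 : 0 < γ := by linarith
  cases m with
  | zero => 
    rw [pow_zero]
    exact one_le_pow₀ (by exact_mod_cast (by omega : 1 ≤ g))
  | succ m =>
    by_contra! hc
    have hpm : 0 < γ ^ (m + 1) := by positivity
    set a := (⌊(g : ℝ) ^ n * x⌋ : ℝ) / (g : ℝ) ^ n with ha
    have hb : ((⌊(g : ℝ) ^ n * x⌋ : ℝ) + 1) / (g : ℝ) ^ n = a + ((g : ℝ) ^ n)⁻¹ := by
      rw [add_div, one_div]
    have hinv : (γ ^ (m + 1))⁻¹ < ((g : ℝ) ^ n)⁻¹ := by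
      rw [inv_lt_inv₀ hpm hp]; exact hc
    have h1 : a ∈ radixCyl g n x := by
      refine ⟨le_rfl, ?_⟩
      rw [hb]
      have : 0 < ((g : ℝ) ^ n)⁻¹ := by positivity
      linarith
    have h2 : a + (γ ^ (m + 1))⁻¹ ∈ radixCyl g n x := by
      have : 0 < (γ ^ (m + 1))⁻¹ := by positivity
      refine ⟨?_, ?_⟩
      · rw [← ha]; linarith
      · rw [hb]; linarith
    have h3 := bm_lin γ a (a + (γ ^ (m + 1))⁻¹) (m + 1) (fun i hi => by
      rw [hm _ h2 i hi, hm _ h1 i hi])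
    rw [add_sub_cancel_left, mul_inv_cancel₀ hpm.ne'] at h3
    have h4 := bm_succ_lt γ (a + (γ ^ (m + 1))⁻¹) m
    have h5 : 0 ≤ (betaMap γ)^[m + 1] a := by
      rw [Function.iterate_succ_apply']
      exact Int.fract_nonneg _
    linarith

lemma m_upper_log (g : ℕ) (hg : 2 ≤ g) (γ : ℝ) (hγ : 1 < γ) (x : ℝ) (n m : ℕ)
    (hm : ∀ y ∈ radixCyl g n x, ∀ i < m, betaDigit γ i y = betaDigit γ i x) :
    (m : ℝ) ≤ n * (Real.log g / Real.log γ) := by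
  have h := m_upper g hg γ hγ x n m hm
  have hγ0 : 0 < γ := by linarith
  have h2 := Real.log_le_log (by positivity) h
  rw [Real.log_pow, Real.log_pow] at h2
  rw [← mul_div_assoc, le_div_iff₀ (Real.log_pos hγ)]
  exact h2

lemma m_bdd (g : ℕ) (hg : 2 ≤ g) (γ : ℝ) (hγ : 1 < γ) (x : ℝ) (n : ℕ) :
    BddAbove {m : ℕ | ∀ y ∈ radixCyl g n x, ∀ i < m, betaDigit γ i y = betaDigit γ i x} := by
  refine ⟨⌊n * (Real.log g / Real.log γ)⌋₊, fun m hm => ?_⟩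
  exact Nat.le_floor (m_upper_log g hg γ hγ x n m hm)

lemma m_le (g : ℕ) (hg : 2 ≤ g) (γ : ℝ) (hγ : 1 < γ) (x : ℝ) (n : ℕ) :
    (mRadixBeta g γ x n : ℝ) ≤ n * (Real.log g / Real.log γ) := by
  apply m_upper_log g hg γ hγ x n
  exact Nat.sSup_mem (s := {m : ℕ | ∀ y ∈ radixCyl g n x, ∀ i < m,
    betaDigit γ i y = betaDigit γ i x}) ⟨0, by simp⟩ (m_bdd g hg γ hγ x n)

lemma m_ge (g : ℕ) (hg : 2 ≤ g) (γ : ℝ) (hγ : 1 < γ) (x : ℝ) (hx : x ∈ Set.Ico (0 : ℝ) 1)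
    (n m : ℕ) (hb : x ∉ badSet γ m ((g : ℝ) ^ n)⁻¹) : m ≤ mRadixBeta g γ x n := by
  apply le_csSup (m_bdd g hg γ hγ x n)
  intro y hy
  by_contra! hc
  have hxm := mem_cyl g hg n x
  classical
  have hfe : ∃ i, i < m ∧ betaDigit γ i y ≠ betaDigit γ i x := hc
  obtain ⟨him, hine⟩ := Nat.find_spec hfe
  have hmin : ∀ j < Nat.find hfe, betaDigit γ j y = betaDigit γ j x := by
    intro j hj
    have := Nat.find_min hfe hj
    by_contra hne
    exact this ⟨hj.trans him, hne⟩
  generalize Nat.find hfe = i at him hine hmin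
  have hy0 := cyl_nonneg g n x hx.1 y hy
  have hz : ∃ z ∈ radixCyl g n x, (betaMap γ)^[i + 1] z = 0 ∧ 0 < (betaMap γ)^[i] z := by
    rcases le_total x y with h | h
    · obtain ⟨z, h1, h2, h3⟩ := bm_jump γ hγ x y hx.1 h i hmin hine
      exact ⟨z, ⟨hxm.1.trans h1, h2.trans_lt hy.2⟩, h3⟩
    · obtain ⟨z, h1, h2, h3⟩ := bm_jump γ hγ y x hy0 h i (fun j hj => (hmin j hj).symm) hine.symm
      exact ⟨z, ⟨hy.1.trans h1, h2.trans_lt hxm.2⟩, h3⟩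
  obtain ⟨z, hzc, h3, h4⟩ := hz
  have d1 := cyl_dist g n x z x hzc hxm
  have d2 := cyl_dist g n x x z hxm hzc
  have hi1 : ((g : ℝ) ^ n)⁻¹ ≤ 1 :=
    inv_le_one_of_one_le₀ (one_le_pow₀ (by exact_mod_cast (by omega : 1 ≤ g)))
  apply hb
  simp only [badSet, Set.mem_iUnion]
  refine ⟨i, Finset.mem_range.2 him, z, ⟨cyl_nonneg g n x hx.1 z hzc, ?_, h3, h4⟩, ?_⟩
  · have := hx.2; linarith
  · rw [Metric.mem_ball, Real.dist_eq, abs_lt]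
    constructor <;> linarith

lemma aux_summable (g : ℕ) (hg : 2 ≤ g) (γ : ℝ) (hγ : 1 < γ) (r : ℝ)
    (hrc : r < Real.log g / Real.log γ) :
    Summable (fun n : ℕ => (6 * r) * ((n : ℝ) ^ 1 * (γ ^ r / g) ^ n)) := by
  have hγ0 : 0 < γ := by linarith
  have hg0 : (0 : ℝ) < g := by exact_mod_cast (by omega : 0 < g)
  have hq0 : 0 ≤ γ ^ r / g := by positivity
  have hq1 : γ ^ r / g < 1 := by
    rw [div_lt_one hg0, ← Real.log_lt_log_iff (by positivity) hg0, Real.log_rpow hγ0]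
    rwa [lt_div_iff₀ (Real.log_pos hγ)] at hrc
  have hn : ‖γ ^ r / g‖ < 1 := by rwa [Real.norm_eq_abs, abs_of_nonneg hq0]
  exact (summable_pow_mul_geometric_of_norm_lt_one 1 hn).mul_left _

lemma aux_bound (g : ℕ) (γ : ℝ) (hγ : 1 < γ) (r : ℝ) (hr : 0 ≤ r) (n : ℕ) :
    volume (badSet γ ⌊r * n⌋₊ ((g : ℝ) ^ n)⁻¹) ≤
      ENNReal.ofReal ((6 * r) * ((n : ℝ) ^ 1 * (γ ^ r / g) ^ n)) := by
  have hγ0 : 0 < γ := by linarith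
  have h1 : (⌊r * n⌋₊ : ℝ) ≤ r * n := Nat.floor_le (by positivity)
  have h2 : γ ^ ⌊r * n⌋₊ ≤ (γ ^ r) ^ n := by
    rw [← Real.rpow_natCast, ← Real.rpow_natCast, ← Real.rpow_mul hγ0.le]
    exact Real.rpow_le_rpow_of_exponent_le hγ.le h1
  refine (bad_meas γ hγ _ _ (by positivity)).trans (ENNReal.ofReal_le_ofReal ?_)
  calc 6 * ((⌊r * n⌋₊ : ℝ) * γ ^ ⌊r * n⌋₊ * ((g : ℝ) ^ n)⁻¹)
      ≤ 6 * ((r * n) * (γ ^ r) ^ n * ((g : ℝ) ^ n)⁻¹) := by gcongr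
    _ = (6 * r) * ((n : ℝ) ^ 1 * (γ ^ r / g) ^ n) := by rw [div_pow]; ring

lemma ae_not_bad (g : ℕ) (hg : 2 ≤ g) (γ : ℝ) (hγ : 1 < γ) (r : ℝ) (hr : 0 ≤ r)
    (hrc : r < Real.log g / Real.log γ) :
    ∀ᵐ x ∂(volume : Measure ℝ), ∀ᶠ n : ℕ in atTop,
      x ∉ badSet γ ⌊r * n⌋₊ ((g : ℝ) ^ n)⁻¹ := by
  have hsum : ∑' n : ℕ, volume (badSet γ ⌊r * n⌋₊ ((g : ℝ) ^ n)⁻¹) ≠ ⊤ :=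
    ne_top_of_le_ne_top (aux_summable g hg γ hγ r hrc).tsum_ofReal_ne_top
      (ENNReal.tsum_le_tsum (aux_bound g γ hγ r hr))
  exact ae_eventually_notMem hsum

theorem radix_vs_pseudo_golden_mean (g : ℕ) (hg : 2 ≤ g) (k : ℕ) (hk : 2 ≤ k)
    (γ : ℝ) (hγ : 1 < γ) (hroot : γ ^ k = ∑ i ∈ Finset.range k, γ ^ i) :
    ∀ᵐ x ∂(volume : Measure ℝ), x ∈ Set.Ico (0 : ℝ) 1 →
      Tendsto (fun n : ℕ => (mRadixBeta g γ x n : ℝ) / n) atTop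
        (nhds (Real.log g / Real.log γ)) := by
  have hg1 : (1 : ℝ) < g := by exact_mod_cast (by omega : 1 < g)
  have hc : 0 < Real.log g / Real.log γ := div_pos (Real.log_pos hg1) (Real.log_pos hγ)
  have hae : ∀ᵐ x ∂(volume : Measure ℝ), ∀ r : ℚ, 0 ≤ (r : ℝ) →
      (r : ℝ) < Real.log g / Real.log γ → ∀ᶠ n : ℕ in atTop,
      x ∉ badSet γ ⌊(r : ℝ) * n⌋₊ ((g : ℝ) ^ n)⁻¹ := by
    rw [ae_all_iff]
    intro r
    by_cases h : 0 ≤ (r : ℝ) ∧ (r : ℝ) < Real.log g / Real.log γ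
    · filter_upwards [ae_not_bad g hg γ hγ r h.1 h.2] with x hx _ _ using hx
    · exact Eventually.of_forall fun x h1 h2 => absurd ⟨h1, h2⟩ h
  filter_upwards [hae] with x hx hx01
  rw [tendsto_order]
  constructor
  · intro a ha
    obtain ⟨r, hr1, hr2⟩ := exists_rat_btwn (max_lt ha hc)
    have hr0 : (0 : ℝ) < r := (le_max_right _ _).trans_lt hr1
    have hra : a < r := (le_max_left _ _).trans_lt hr1
    have hlim : Tendsto (fun n : ℕ => (r : ℝ) - 1 / (n : ℝ)) atTop (nhds ((r : ℝ) - 0)) :=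
      tendsto_const_nhds.sub tendsto_one_div_atTop_nhds_zero_nat
    rw [sub_zero] at hlim
    filter_upwards [hx r hr0.le hr2, hlim.eventually (lt_mem_nhds hra), eventually_gt_atTop 0]
      with n h1 h2 h3
    have h4 := m_ge g hg γ hγ x hx01 n _ h1
    have h5 : (⌊(r : ℝ) * n⌋₊ : ℝ) ≤ mRadixBeta g γ x n := by exact_mod_cast h4
    have h6 := Nat.lt_floor_add_one ((r : ℝ) * n)
    have hn : (0 : ℝ) < n := by exact_mod_cast h3
    refine h2.trans_le ?_
    rw [le_div_iff₀ hn, sub_mul, one_div, inv_mul_cancel₀ hn.ne']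
    linarith
  · intro a ha
    filter_upwards [eventually_gt_atTop 0] with n h3
    have hn : (0 : ℝ) < n := by exact_mod_cast h3
    refine lt_of_le_of_lt ?_ ha
    rw [div_le_iff₀ hn, mul_comm]
    exact m_le g hg γ hγ x n
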